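/- Let G = yzwuv ∈ S. For every D ∈ S with 2D = φ(f+2G) − (f+2G)², one has ρ(f·D) ∈ m^[4] = (x⁴, y⁴, z⁴, w⁴, u⁴, v⁴) and ρ(f·D³) ≡ x⁵y⁶z⁶w⁶u⁶v⁶ modulo m^[8] = (x⁸, y⁸, z⁸, w⁸, u⁸, v⁸); in particular ρ(f·D³) ∉ m^[8]. (This is the computational content of the statement that W(k)[x,y,z,w,u,v]/(f + 2yzwuv) has quasi-F-splitting height exactly 3.) -/

import Mathlib

open MvPolynomial

/-- In characteristic two, with the eighth powers of six elements vanishing, the product `f * D ^ 3`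
attached to the Fermat quintic collapses to a single monomial. -/
lemma fermat_quintic_mul_cube {Q : Type*} [CommRing Q] (h2 : (2 : Q) = 0) {a b c d e g : Q}
    (ha : a ^ 8 = 0) (hb : b ^ 8 = 0) (hc : c ^ 8 = 0) (hd : d ^ 8 = 0) (he : e ^ 8 = 0)
    (hg : g ^ 8 = 0) :
    (a ^ 5 + b ^ 5 + c ^ 5 + d ^ 5 + e ^ 5 + g ^ 5) *
      (a ^ 5 * (b ^ 5 + c ^ 5 + d ^ 5 + e ^ 5 + g ^ 5) + b ^ 5 * (c ^ 5 + d ^ 5 + e ^ 5 + g ^ 5) +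
        c ^ 5 * (d ^ 5 + e ^ 5 + g ^ 5) + d ^ 5 * (e ^ 5 + g ^ 5) + e ^ 5 * g ^ 5 +
        (b * c * d * e * g) ^ 2) ^ 3 =
      a ^ 5 * b ^ 6 * c ^ 6 * d ^ 6 * e ^ 6 * g ^ 6 := by
  have add_sq_two (p q : Q) : (p + q) ^ 2 = p ^ 2 + q ^ 2 := by linear_combination p * q * h2
  have sq_zero {p : Q} (hp : p ^ 8 = 0) : (p ^ 5) ^ 2 = 0 := by linear_combination p ^ 2 * hp
  have mul_zero_of {p q : Q} (hp : p ^ 8 = 0) : p ^ 5 * (p * q) ^ 4 = 0 := by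
    linear_combination p * q ^ 4 * hp
  set G := b * c * d * e * g with hG
  have hbG : b ^ 5 * G ^ 4 = 0 := by
    rw [hG, show b * c * d * e * g = b * (c * d * e * g) by ring, mul_zero_of hb]
  have hcG : c ^ 5 * G ^ 4 = 0 := by
    rw [hG, show b * c * d * e * g = c * (b * d * e * g) by ring, mul_zero_of hc]
  have hdG : d ^ 5 * G ^ 4 = 0 := by
    rw [hG, show b * c * d * e * g = d * (b * c * e * g) by ring, mul_zero_of hd]
  have heG : e ^ 5 * G ^ 4 = 0 := by
    rw [hG, show b * c * d * e * g = e * (b * c * d * g) by ring, mul_zero_of he]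
  have hgG : g ^ 5 * G ^ 4 = 0 := by
    rw [hG, show b * c * d * e * g = g * (b * c * d * e) by ring, mul_zero_of hg]
  have hmono : a ^ 5 * b ^ 6 * c ^ 6 * d ^ 6 * e ^ 6 * g ^ 6 = a ^ 5 * G ^ 6 := by
    rw [hG]; ring
  rw [hmono]
  clear_value G
  replace ha := sq_zero ha
  replace hb := sq_zero hb
  replace hc := sq_zero hc
  replace hd := sq_zero hd
  replace he := sq_zero he
  replace hg := sq_zero hg
  generalize a ^ 5 = A at *
  generalize b ^ 5 = B at *
  generalize c ^ 5 = C at *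
  generalize d ^ 5 = D at *
  generalize e ^ 5 = E at *
  generalize g ^ 5 = F at *
  have hsq : (A * (B + C + D + E + F) + B * (C + D + E + F) + C * (D + E + F) + D * (E + F) +
      E * F) ^ 2 = 0 := by
    simp only [add_sq_two, mul_pow, ha, hb, hc, hd, he, hg, zero_mul, add_zero]
  have hG4 : (A * (B + C + D + E + F) + B * (C + D + E + F) + C * (D + E + F) + D * (E + F) +
      E * F) * G ^ 4 = 0 := by
    linear_combination (A * hbG + (A + B) * hcG + (A + B + C) * hdG + (A + B + C + D) * heG +
      (A + B + C + D + E) * hgG)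
  generalize A * (B + C + D + E + F) + B * (C + D + E + F) + C * (D + E + F) + D * (E + F) +
      E * F = P at *
  linear_combination (A + B + C + D + E + F) * (P + 3 * G ^ 2) * hsq +
    3 * (A + B + C + D + E + F) * hG4 + G ^ 2 * (hbG + hcG + hdG + heG + hgG)

/-- Ideal form of `fermat_quintic_mul_cube`. -/
lemma fermat_quintic_mul_cube_sub_mem {R : Type*} [CommRing R] (h2 : (2 : R) = 0) {I : Ideal R}
    {a b c d e g : R} (ha : a ^ 8 ∈ I) (hb : b ^ 8 ∈ I) (hc : c ^ 8 ∈ I) (hd : d ^ 8 ∈ I)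
    (he : e ^ 8 ∈ I) (hg : g ^ 8 ∈ I) :
    (a ^ 5 + b ^ 5 + c ^ 5 + d ^ 5 + e ^ 5 + g ^ 5) *
      (a ^ 5 * (b ^ 5 + c ^ 5 + d ^ 5 + e ^ 5 + g ^ 5) + b ^ 5 * (c ^ 5 + d ^ 5 + e ^ 5 + g ^ 5) +
        c ^ 5 * (d ^ 5 + e ^ 5 + g ^ 5) + d ^ 5 * (e ^ 5 + g ^ 5) + e ^ 5 * g ^ 5 +
        (b * c * d * e * g) ^ 2) ^ 3 -
      a ^ 5 * b ^ 6 * c ^ 6 * d ^ 6 * e ^ 6 * g ^ 6 ∈ I := by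
  have hmk {x : R} (hx : x ^ 8 ∈ I) : Ideal.Quotient.mk I x ^ 8 = 0 := by
    rwa [← map_pow, Ideal.Quotient.eq_zero_iff_mem]
  have h2I : (2 : R ⧸ I) = 0 := by
    rw [← map_ofNat (Ideal.Quotient.mk I), h2, map_zero]
  rw [← Ideal.Quotient.eq]
  simp only [map_mul, map_add, map_pow]
  exact fermat_quintic_mul_cube h2I (hmk ha) (hmk hb) (hmk hc) (hmk hd) (hmk he) (hmk hg)

/-- The difference between the Frobenius lift and the square of `f + 2 * G`, divided by two. -/
lemma fermat_quintic_delta {R : Type*} [CommRing R] (a b c d e g G : R) :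
    a ^ 10 + b ^ 10 + c ^ 10 + d ^ 10 + e ^ 10 + g ^ 10 + 2 * G ^ 2 -
      (a ^ 5 + b ^ 5 + c ^ 5 + d ^ 5 + e ^ 5 + g ^ 5 + 2 * G) ^ 2 =
    2 * (a ^ 5 * (b ^ 5 + c ^ 5 + d ^ 5 + e ^ 5 + g ^ 5) + b ^ 5 * (c ^ 5 + d ^ 5 + e ^ 5 + g ^ 5) +
        c ^ 5 * (d ^ 5 + e ^ 5 + g ^ 5) + d ^ 5 * (e ^ 5 + g ^ 5) + e ^ 5 * g ^ 5 + G ^ 2 -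
      2 * (a ^ 5 * (b ^ 5 + c ^ 5 + d ^ 5 + e ^ 5 + g ^ 5) +
        b ^ 5 * (c ^ 5 + d ^ 5 + e ^ 5 + g ^ 5) + c ^ 5 * (d ^ 5 + e ^ 5 + g ^ 5) +
        d ^ 5 * (e ^ 5 + g ^ 5) + e ^ 5 * g ^ 5 + G ^ 2 +
        (a ^ 5 + b ^ 5 + c ^ 5 + d ^ 5 + e ^ 5 + g ^ 5) * G)) := by
  ring

/-- The Fermat quintic lies in any ideal containing the fourth powers of its variables. -/
lemma fermat_quintic_mem {R : Type*} [CommRing R] {I : Ideal R} {a b c d e g : R}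
    (ha : a ^ 4 ∈ I) (hb : b ^ 4 ∈ I) (hc : c ^ 4 ∈ I) (hd : d ^ 4 ∈ I) (he : e ^ 4 ∈ I)
    (hg : g ^ 4 ∈ I) : a ^ 5 + b ^ 5 + c ^ 5 + d ^ 5 + e ^ 5 + g ^ 5 ∈ I := by
  have h {x : R} (hx : x ^ 4 ∈ I) : x ^ 5 ∈ I := I.pow_mem_of_pow_mem hx (by norm_num)
  exact add_mem (add_mem (add_mem (add_mem (add_mem (h ha) (h hb)) (h hc)) (h hd)) (h he)) (h hg)

/-- Each `n`-th power of a variable lies in the `n`-th bracket power. -/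
lemma X_pow_mem_span_X_pow {k : Type*} [CommSemiring k] (n : ℕ) (i : Fin 6) :
    (X i : MvPolynomial (Fin 6) k) ^ n ∈
      Ideal.span ({X 0 ^ n, X 1 ^ n, X 2 ^ n, X 3 ^ n, X 4 ^ n, X 5 ^ n} :
        Set (MvPolynomial (Fin 6) k)) := by
  apply Ideal.subset_span
  fin_cases i <;> simp

/-- A monomial with all exponents below `n` lies outside the `n`-th bracket power of the ideal
generated by the six variables. -/
lemma monomial_notMem_span_X_pow {k : Type*} [CommSemiring k] [Nontrivial k] {n : ℕ}
    {s : Fin 6 →₀ ℕ} (hs : ∀ i, s i < n) :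
    monomial s (1 : k) ∉ Ideal.span ({X 0 ^ n, X 1 ^ n, X 2 ^ n, X 3 ^ n, X 4 ^ n, X 5 ^ n} :
      Set (MvPolynomial (Fin 6) k)) := by
  have himage : ({X 0 ^ n, X 1 ^ n, X 2 ^ n, X 3 ^ n, X 4 ^ n, X 5 ^ n} :
      Set (MvPolynomial (Fin 6) k)) =
      (fun t => monomial t (1 : k)) '' Set.range (fun i : Fin 6 => Finsupp.single i n) := by
    ext p
    simp [X_pow_eq_monomial, Fin.exists_fin_succ, eq_comm]
  rw [himage, mem_ideal_span_monomial_image]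
  intro h
  obtain ⟨_, ⟨i, rfl⟩, hi⟩ := h s (by simp)
  have := hi i
  simp only [Finsupp.single_eq_same] at this
  exact absurd this (hs i).not_ge

/-- Fermat quintic fourfold: `W(k)[x,y,z,w,u,v]/(f + 2yzwuv)` has
quasi-F-splitting height 3. With notation as in the Fermat quintic setting
(`f = x⁵ + y⁵ + z⁵ + w⁵ + u⁵ + v⁵`, characteristic 2) and `G = yzwuv`:
for every `D ∈ S` with `2D = φ(f+2G) − (f+2G)²`, one has
`ρ(f·D) ∈ (x⁴, y⁴, z⁴, w⁴, u⁴, v⁴)` and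
`ρ(f·D³) ≡ x⁵y⁶z⁶w⁶u⁶v⁶  mod (x⁸, y⁸, z⁸, w⁸, u⁸, v⁸)`;
in particular `ρ(f·D³) ∉ (x⁸, y⁸, z⁸, w⁸, u⁸, v⁸)`. -/
theorem stmt19 (k : Type*) [Field k] [IsAlgClosed k] [CharP k 2]
    (φ : MvPolynomial (Fin 6) (WittVector 2 k) →+* MvPolynomial (Fin 6) (WittVector 2 k))
    (hφC : ∀ α : WittVector 2 k, φ (C α) = C (WittVector.frobenius α))
    (hφX : ∀ i : Fin 6, φ (X i) = X i ^ 2)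
    (r : WittVector 2 k →+* k)
    (hr : ∀ α : WittVector 2 k, r α = α.coeff 0)
    (f : MvPolynomial (Fin 6) (WittVector 2 k))
    (hf : f = X 0 ^ 5 + X 1 ^ 5 + X 2 ^ 5 + X 3 ^ 5 + X 4 ^ 5 + X 5 ^ 5)
    (G : MvPolynomial (Fin 6) (WittVector 2 k))
    (hG : G = X 1 * X 2 * X 3 * X 4 * X 5)
    (D : MvPolynomial (Fin 6) (WittVector 2 k))
    (hD : 2 * D = φ (f + 2 * G) - (f + 2 * G) ^ 2) :
    MvPolynomial.map r (f * D)
        ∈ Ideal.span ({X 0 ^ 4, X 1 ^ 4, X 2 ^ 4, X 3 ^ 4, X 4 ^ 4, X 5 ^ 4} :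
            Set (MvPolynomial (Fin 6) k)) ∧
    MvPolynomial.map r (f * D ^ 3) -
        X 0 ^ 5 * X 1 ^ 6 * X 2 ^ 6 * X 3 ^ 6 * X 4 ^ 6 * X 5 ^ 6
        ∈ Ideal.span ({X 0 ^ 8, X 1 ^ 8, X 2 ^ 8, X 3 ^ 8, X 4 ^ 8, X 5 ^ 8} :
            Set (MvPolynomial (Fin 6) k)) ∧
    MvPolynomial.map r (f * D ^ 3)
        ∉ Ideal.span ({X 0 ^ 8, X 1 ^ 8, X 2 ^ 8, X 3 ^ 8, X 4 ^ 8, X 5 ^ 8} :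
            Set (MvPolynomial (Fin 6) k)) := by
  have hmap (g : MvPolynomial (Fin 6) (WittVector 2 k)) : map r (2 * g) = 0 := by
    rw [map_mul, map_ofNat, CharTwo.two_eq_zero, zero_mul]
  have hD' : D = X 0 ^ 5 * (X 1 ^ 5 + X 2 ^ 5 + X 3 ^ 5 + X 4 ^ 5 + X 5 ^ 5) +
      X 1 ^ 5 * (X 2 ^ 5 + X 3 ^ 5 + X 4 ^ 5 + X 5 ^ 5) + X 2 ^ 5 * (X 3 ^ 5 + X 4 ^ 5 + X 5 ^ 5) +
      X 3 ^ 5 * (X 4 ^ 5 + X 5 ^ 5) + X 4 ^ 5 * X 5 ^ 5 + G ^ 2 -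
      2 * (X 0 ^ 5 * (X 1 ^ 5 + X 2 ^ 5 + X 3 ^ 5 + X 4 ^ 5 + X 5 ^ 5) +
        X 1 ^ 5 * (X 2 ^ 5 + X 3 ^ 5 + X 4 ^ 5 + X 5 ^ 5) +
        X 2 ^ 5 * (X 3 ^ 5 + X 4 ^ 5 + X 5 ^ 5) +
        X 3 ^ 5 * (X 4 ^ 5 + X 5 ^ 5) + X 4 ^ 5 * X 5 ^ 5 + G ^ 2 + f * G) := by
    have htwo : (2 : MvPolynomial (Fin 6) (WittVector 2 k)) ≠ 0 := by
      rw [← map_ofNat C, Ne, C_eq_zero]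
      exact_mod_cast WittVector.p_nonzero 2 k
    refine mul_left_cancel₀ htwo ?_
    have hφG : φ G = G ^ 2 := by
      simp only [hG, map_mul, hφX]; ring
    have hφf : φ f = X 0 ^ 10 + X 1 ^ 10 + X 2 ^ 10 + X 3 ^ 10 + X 4 ^ 10 + X 5 ^ 10 := by
      simp only [hf, map_add, map_pow, hφX]; ring
    rw [hD, map_add, map_mul, map_ofNat, hφG, hφf, hf]
    exact fermat_quintic_delta _ _ _ _ _ _ _
  have hρf : map r f = X 0 ^ 5 + X 1 ^ 5 + X 2 ^ 5 + X 3 ^ 5 + X 4 ^ 5 + X 5 ^ 5 := by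
    simp [hf]
  have hρD : map r D = X 0 ^ 5 * (X 1 ^ 5 + X 2 ^ 5 + X 3 ^ 5 + X 4 ^ 5 + X 5 ^ 5) +
      X 1 ^ 5 * (X 2 ^ 5 + X 3 ^ 5 + X 4 ^ 5 + X 5 ^ 5) + X 2 ^ 5 * (X 3 ^ 5 + X 4 ^ 5 + X 5 ^ 5) +
      X 3 ^ 5 * (X 4 ^ 5 + X 5 ^ 5) + X 4 ^ 5 * X 5 ^ 5 +
      (X 1 * X 2 * X 3 * X 4 * X 5) ^ 2 := by
    rw [hD', map_sub, hmap, sub_zero, hG]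
    simp
  have hcube : map r (f * D ^ 3) - X 0 ^ 5 * X 1 ^ 6 * X 2 ^ 6 * X 3 ^ 6 * X 4 ^ 6 * X 5 ^ 6
      ∈ Ideal.span ({X 0 ^ 8, X 1 ^ 8, X 2 ^ 8, X 3 ^ 8, X 4 ^ 8, X 5 ^ 8} :
          Set (MvPolynomial (Fin 6) k)) := by
    rw [map_mul, map_pow, hρf, hρD]
    refine fermat_quintic_mul_cube_sub_mem CharTwo.two_eq_zero ?_ ?_ ?_ ?_ ?_ ?_ <;>
      exact X_pow_mem_span_X_pow _ _
  refine ⟨?_, hcube, fun hmem => ?_⟩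
  · rw [map_mul, hρf]
    refine Ideal.mul_mem_right _ _ (fermat_quintic_mem ?_ ?_ ?_ ?_ ?_ ?_) <;>
      exact X_pow_mem_span_X_pow _ _
  · have hmono := (Submodule.sub_mem_iff_right _ hmem).mp hcube
    have hexp : ∀ i, Finsupp.equivFunOnFinite.symm ![5, 6, 6, 6, 6, 6] i < 8 := by decide
    refine monomial_notMem_span_X_pow (k := k) hexp ?_
    rw [monomial_eq, C_1, one_mul, Finsupp.prod_fintype _ _ fun _ => pow_zero _, Fin.prod_univ_six]
    exact hmono
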